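/- Suppose Assumption 1 holds with constant α ∈ (0,1]. Let Ω̃ be the restricted estimator, Ψ := Ω̃ − Ω̄ and R(Ψ) := Ω̃^{-1} − Σ̄ + Σ̄ΨΣ̄. If r := 2κ_Γ̄(λ/T + ‖Σ_{k=1}^K (T^{(k)}/T)W^{(k)}‖_∞) ≤ min{1/(3κ_Σ̄ d), 1/(3κ_Σ̄³κ_Γ̄ d)}, then ‖Ψ‖_∞ ≤ r and ‖R(Ψ)‖_∞ ≤ (3/2)·d·‖Ψ‖_∞²·κ_Σ̄³. -/

import Mathlib

open Matrix BigOperators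
open scoped Classical

/-- Frobenius inner product `⟨A,B⟩ = ∑_{i,j} A_{ij} B_{ij}`. -/
noncomputable def frobInner {N : ℕ} (A B : Matrix (Fin N) (Fin N) ℝ) : ℝ :=
  ∑ i, ∑ j, A i j * B i j

/-- Entrywise ℓ₁ norm `‖A‖₁ = ∑_{i,j} |A_{ij}|`. -/
noncomputable def matL1Norm {N : ℕ} (A : Matrix (Fin N) (Fin N) ℝ) : ℝ :=
  ∑ i, ∑ j, |A i j|

/-- Entrywise ℓ∞ norm `‖A‖_∞ = max_{i,j} |A_{ij}|`. -/
noncomputable def elemInf {N : ℕ} (A : Matrix (Fin N) (Fin N) ℝ) : ℝ :=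
  ⨆ p : Fin N × Fin N, |A p.1 p.2|

/-- ℓ∞ operator norm `|||A|||_∞ = max_i ∑_j |A_{ij}|`. -/
noncomputable def opInf {m n : Type*} [Fintype n] (A : Matrix m n ℝ) : ℝ :=
  ⨆ i, ∑ j, |A i j|

/-- Support of a matrix: the set of indices of nonzero entries. -/
def matSupp {N : ℕ} (A : Matrix (Fin N) (Fin N) ℝ) : Set (Fin N × Fin N) :=
  {p | A p.1 p.2 ≠ 0}

/-- The Kronecker product with pair indices: `[A ⊗ B]_{(i,k),(j,l)} = A_{ij} B_{kl}`. -/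
noncomputable def kron {N : ℕ} (A B : Matrix (Fin N) (Fin N) ℝ) :
    Matrix (Fin N × Fin N) (Fin N × Fin N) ℝ :=
  fun p q => A p.1 q.1 * B p.2 q.2

/-- The submatrix `Γ̄_{SS}` of `Γ̄ = Σ̄ ⊗ Σ̄`. -/
noncomputable def gammaSS {N : ℕ} (Sig : Matrix (Fin N) (Fin N) ℝ)
    (S : Set (Fin N × Fin N)) : Matrix ↥S ↥S ℝ :=
  fun p q => kron Sig Sig p.val q.val

/-- The submatrix `Γ̄_{S^c S}` of `Γ̄ = Σ̄ ⊗ Σ̄`. -/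
noncomputable def gammaScS {N : ℕ} (Sig : Matrix (Fin N) (Fin N) ℝ)
    (S : Set (Fin N × Fin N)) : Matrix ↥Sᶜ ↥S ℝ :=
  fun p q => kron Sig Sig p.val q.val

/-- `κ_Γ̄ := |||(Γ̄_{SS})⁻¹|||_∞`. -/
noncomputable def kappaGamma {N : ℕ} (Sig : Matrix (Fin N) (Fin N) ℝ)
    (S : Set (Fin N × Fin N)) : ℝ :=
  opInf (gammaSS Sig S)⁻¹

/-- Mutual incoherence (Assumption 1): `|||Γ̄_{S^cS}(Γ̄_{SS})⁻¹|||_∞ ≤ 1 − α`. -/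
noncomputable def MutualIncoherence {N : ℕ} (Sig : Matrix (Fin N) (Fin N) ℝ)
    (S : Set (Fin N × Fin N)) (α : ℝ) : Prop :=
  opInf (gammaScS Sig S * (gammaSS Sig S)⁻¹) ≤ 1 - α

/-- Maximal row-support size (degree) of a matrix. -/
noncomputable def matDegree {N : ℕ} (A : Matrix (Fin N) (Fin N) ℝ) : ℕ :=
  Finset.sup Finset.univ fun i => (Finset.univ.filter fun j => A i j ≠ 0).card

section Norms

variable {N : ℕ} {m n l : Type*} [Fintype n] [Fintype l]

lemma abs_le_elemInf (A : Matrix (Fin N) (Fin N) ℝ) (i j : Fin N) : |A i j| ≤ elemInf A :=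
  le_ciSup (f := fun p : Fin N × Fin N => |A p.1 p.2|) (Set.finite_range _).bddAbove (i, j)

lemma elemInf_le {A : Matrix (Fin N) (Fin N) ℝ} {c : ℝ} (hc : 0 ≤ c)
    (h : ∀ i j, |A i j| ≤ c) : elemInf A ≤ c :=
  Real.iSup_le (fun p => h p.1 p.2) hc

lemma elemInf_nonneg (A : Matrix (Fin N) (Fin N) ℝ) : 0 ≤ elemInf A :=
  Real.iSup_nonneg fun _ => abs_nonneg _

lemma row_sum_le_opInf [Finite m] (A : Matrix m n ℝ) (i : m) : ∑ j, |A i j| ≤ opInf A :=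
  le_ciSup (f := fun i => ∑ j, |A i j|) (Set.finite_range _).bddAbove i

lemma opInf_le {A : Matrix m n ℝ} {c : ℝ} (hc : 0 ≤ c) (h : ∀ i, ∑ j, |A i j| ≤ c) :
    opInf A ≤ c :=
  Real.iSup_le h hc

lemma opInf_nonneg (A : Matrix m n ℝ) : 0 ≤ opInf A :=
  Real.iSup_nonneg fun _ => Finset.sum_nonneg fun _ _ => abs_nonneg _

lemma abs_mulVec_le [Finite m] (A : Matrix m n ℝ) {v : n → ℝ} {c : ℝ} (h : ∀ j, |v j| ≤ c) (i : m) :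
    |(A *ᵥ v) i| ≤ opInf A * c := by
  calc |(A *ᵥ v) i| ≤ ∑ j, |A i j * v j| := Finset.abs_sum_le_sum_abs _ _
    _ ≤ ∑ j, |A i j| * c := Finset.sum_le_sum fun j _ => by
        rw [abs_mul]; exact mul_le_mul_of_nonneg_left (h j) (abs_nonneg _)
    _ = (∑ j, |A i j|) * c := (Finset.sum_mul ..).symm
    _ ≤ opInf A * c := by
        rcases isEmpty_or_nonempty n with hn | ⟨⟨j⟩⟩
        · simp [opInf]
        · exact mul_le_mul_of_nonneg_right (row_sum_le_opInf A i) ((abs_nonneg _).trans (h j))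

lemma opInf_mul_le [Finite m] (A : Matrix m n ℝ) (B : Matrix n l ℝ) :
    opInf (A * B) ≤ opInf A * opInf B := by
  refine opInf_le (mul_nonneg (opInf_nonneg _) (opInf_nonneg _)) fun i => ?_
  calc ∑ k, |(A * B) i k| ≤ ∑ k, ∑ j, |A i j| * |B j k| := Finset.sum_le_sum fun k _ => by
        simpa only [mul_apply, abs_mul] using
          Finset.abs_sum_le_sum_abs (fun j => A i j * B j k) Finset.univ
    _ = ∑ j, |A i j| * ∑ k, |B j k| := by
        rw [Finset.sum_comm]; simp only [Finset.mul_sum]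
    _ ≤ ∑ j, |A i j| * opInf B := Finset.sum_le_sum fun j _ =>
        mul_le_mul_of_nonneg_left (row_sum_le_opInf B j) (abs_nonneg _)
    _ = (∑ j, |A i j|) * opInf B := (Finset.sum_mul ..).symm
    _ ≤ opInf A * opInf B :=
        mul_le_mul_of_nonneg_right (row_sum_le_opInf A i) (opInf_nonneg _)

lemma opInf_sub_le [Finite m] (A B : Matrix m n ℝ) : opInf (A - B) ≤ opInf A + opInf B := by
  refine opInf_le (add_nonneg (opInf_nonneg _) (opInf_nonneg _)) fun i => ?_
  calc ∑ j, |(A - B) i j| ≤ ∑ j, (|A i j| + |B i j|) :=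
        Finset.sum_le_sum fun j _ => abs_sub (A i j) (B i j)
    _ = ∑ j, |A i j| + ∑ j, |B i j| := Finset.sum_add_distrib
    _ ≤ opInf A + opInf B := add_le_add (row_sum_le_opInf A i) (row_sum_le_opInf B i)

lemma opInf_smul (c : ℝ) (A : Matrix m n ℝ) : opInf (c • A) = |c| * opInf A := by
  simp only [opInf, Matrix.smul_apply, smul_eq_mul, abs_mul, ← Finset.mul_sum]
  exact (Real.mul_iSup_of_nonneg (abs_nonneg c) _).symm

lemma elemInf_mul_le (A B : Matrix (Fin N) (Fin N) ℝ) :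
    elemInf (A * B) ≤ opInf A * elemInf B :=
  elemInf_le (mul_nonneg (opInf_nonneg _) (elemInf_nonneg _)) fun i j =>
    abs_mulVec_le A (fun k => abs_le_elemInf B k j) i

lemma elemInf_transpose (A : Matrix (Fin N) (Fin N) ℝ) : elemInf Aᵀ = elemInf A :=
  le_antisymm (elemInf_le (elemInf_nonneg _) fun i j => abs_le_elemInf A j i)
    (elemInf_le (elemInf_nonneg _) fun i j => abs_le_elemInf Aᵀ j i)

lemma elemInf_mul_le_transpose (A B : Matrix (Fin N) (Fin N) ℝ) :
    elemInf (A * B) ≤ elemInf A * opInf Bᵀ := by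
  rw [← elemInf_transpose, transpose_mul, mul_comm, ← elemInf_transpose A]
  exact elemInf_mul_le _ _

lemma elemInf_add_le (A B : Matrix (Fin N) (Fin N) ℝ) :
    elemInf (A + B) ≤ elemInf A + elemInf B :=
  elemInf_le (add_nonneg (elemInf_nonneg _) (elemInf_nonneg _)) fun i j =>
    (abs_add_le _ _).trans (add_le_add (abs_le_elemInf A i j) (abs_le_elemInf B i j))

lemma opInf_le_matDegree_mul {Ω Ψ : Matrix (Fin N) (Fin N) ℝ}
    (h : ∀ p : Fin N × Fin N, p ∉ matSupp Ω → Ψ p.1 p.2 = 0) :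
    opInf Ψ ≤ matDegree Ω * elemInf Ψ := by
  refine opInf_le (mul_nonneg (Nat.cast_nonneg _) (elemInf_nonneg _)) fun i => ?_
  calc ∑ j, |Ψ i j| = ∑ j ∈ Finset.univ.filter fun j => Ω i j ≠ 0, |Ψ i j| := by
        refine (Finset.sum_subset (Finset.subset_univ _) fun j _ hj => ?_).symm
        rw [h (i, j) (by simpa [matSupp] using hj), abs_zero]
    _ ≤ (Finset.univ.filter fun j => Ω i j ≠ 0).card • elemInf Ψ :=
        Finset.sum_le_card_nsmul _ _ _ fun j _ => abs_le_elemInf Ψ i j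
    _ ≤ matDegree Ω * elemInf Ψ := by
        rw [nsmul_eq_mul]
        refine mul_le_mul_of_nonneg_right (Nat.cast_le.2 ?_) (elemInf_nonneg _)
        exact Finset.le_sup (f := fun i => (Finset.univ.filter fun j => Ω i j ≠ 0).card)
          (Finset.mem_univ i)

end Norms

section PosDef

variable {N : ℕ}

lemma posDef_inv_eq {A : Matrix (Fin N) (Fin N) ℝ} (hA : A.PosDef) :
    ∃ L : Matrix (Fin N) (Fin N) ℝ, IsUnit L ∧ A⁻¹ = Lᵀ * L := by
  open scoped MatrixOrder in
  obtain ⟨L, hL⟩ := CStarAlgebra.nonneg_iff_eq_star_mul_self.mp hA.inv.posSemidef.nonneg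
  refine ⟨L, ?_, by simpa [star_eq_conjTranspose] using hL⟩
  have h : IsUnit (star L * L) := hL ▸ hA.inv.isUnit
  rw [isUnit_iff_isUnit_det, det_mul] at h
  exact (isUnit_iff_isUnit_det _).2 (isUnit_of_mul_isUnit_right h)

lemma posDef_add_of_opInf_lt_one {Ω Ψ : Matrix (Fin N) (Fin N) ℝ} (hΩ : Ω.PosDef)
    (hΨ : Ψ.IsHermitian) (h : opInf (Ω⁻¹ * Ψ) < 1) : (Ω + Ψ).PosDef := by
  obtain ⟨L, hL, hLL⟩ := posDef_inv_eq hΩ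
  have hB : (Ω + Ψ).IsHermitian := hΩ.isHermitian.add hΨ
  rw [← hL.posDef_star_right_conjugate_iff]
  have hC : (L * (Ω + Ψ) * star L).IsHermitian := isHermitian_mul_mul_conjTranspose L hB
  rw [hC.posDef_iff_eigenvalues_pos]
  intro i
  set μ := hC.eigenvalues i
  set v := (hC.eigenvectorBasis i).ofLp
  have hv : v ≠ 0 := by
    have := (hC.eigenvectorBasis.orthonormal).ne_zero i
    simpa [v] using this
  have hCv : (L * (Ω + Ψ) * star L) *ᵥ v = μ • v := hC.mulVec_eigenvectorBasis i
  have hLs : star L = Lᵀ := by simp [star_eq_conjTranspose]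
  rw [hLs] at hCv
  set w := Lᵀ *ᵥ v with hw
  have hw0 : w ≠ 0 := by
    intro h0
    refine hv (mulVec_injective_of_isUnit (hL.star) ?_)
    rw [mulVec_zero, hLs, ← hw, h0]
  have hdet : IsUnit Ω.det := (isUnit_iff_isUnit_det _).1 hΩ.isUnit
  have hBw : (Ω⁻¹ * Ψ) *ᵥ w = (μ - 1) • w := by
    have h1 : (Ω⁻¹ * (Ω + Ψ)) *ᵥ w = μ • w := by
      rw [hLL, hw, mulVec_mulVec, mul_assoc, mul_assoc, ← mulVec_mulVec, ← mul_assoc, hCv,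
        mulVec_smul]
    rw [mul_add, nonsing_inv_mul _ hdet, add_mulVec, one_mulVec] at h1
    rw [sub_smul, one_smul, ← h1, add_sub_cancel_left]
  have hle : |μ - 1| * ‖w‖ ≤ opInf (Ω⁻¹ * Ψ) * ‖w‖ := by
    rw [← Real.norm_eq_abs, ← norm_smul, ← hBw]
    refine (pi_norm_le_iff_of_nonneg (mul_nonneg (opInf_nonneg _) (norm_nonneg _))).2 fun j => ?_
    exact abs_mulVec_le _ (fun j => norm_le_pi_norm w j) j
  have := (le_of_mul_le_mul_right hle (norm_pos_iff.2 hw0)).trans_lt h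
  linarith [(abs_lt.1 this).1]

lemma inv_mul_mul_inv_eq {A B : Matrix (Fin N) (Fin N) ℝ} (hA : A.PosDef) (hB : B.PosDef) :
    A⁻¹ - B⁻¹ = A⁻¹ * (B - A) * B⁻¹ := by
  have hA' : IsUnit A.det := (isUnit_iff_isUnit_det _).1 hA.isUnit
  have hB' : IsUnit B.det := (isUnit_iff_isUnit_det _).1 hB.isUnit
  rw [mul_sub, sub_mul, mul_assoc, mul_nonsing_inv _ hB', nonsing_inv_mul _ hA', mul_one, one_mul]

/-- Two positive definite matrices that agree off `S` and whose inverses agree on `S` coincide. -/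
lemma posDef_eq_of_inv_eqOn {A B : Matrix (Fin N) (Fin N) ℝ} (hA : A.PosDef) (hB : B.PosDef)
    {S : Set (Fin N × Fin N)} (hoff : ∀ p, p ∉ S → A p.1 p.2 = B p.1 p.2)
    (hon : ∀ p, p ∈ S → A⁻¹ p.1 p.2 = B⁻¹ p.1 p.2) : A = B := by
  obtain ⟨L, hL, hLL⟩ := posDef_inv_eq hA
  obtain ⟨M, hM, hMM⟩ := posDef_inv_eq hB
  set D := B - A with hD
  have hDt : Dᵀ = D := by
    simpa only [conjTranspose_eq_transpose_of_trivial] using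
      (hB.isHermitian.sub hA.isHermitian).eq
  have htr : ((A⁻¹ - B⁻¹) * Dᵀ).trace = 0 := by
    simp only [trace, diag_apply, mul_apply, transpose_apply]
    refine Finset.sum_eq_zero fun i _ => Finset.sum_eq_zero fun j _ => ?_
    by_cases h : (i, j) ∈ S
    · simp [hon _ h]
    · simp [hD, hoff _ h]
  rw [inv_mul_mul_inv_eq hA hB, ← hD, hDt, hLL, hMM] at htr
  have htr' : ((M * D * Lᵀ)ᴴ * (M * D * Lᵀ)).trace = 0 := by
    rw [← htr, conjTranspose_eq_transpose_of_trivial]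
    simp only [transpose_mul, transpose_transpose, hDt]
    rw [← mul_assoc, trace_mul_comm]
    simp only [mul_assoc]
  rw [trace_conjTranspose_mul_self_eq_zero_iff] at htr'
  have hLt : IsUnit Lᵀ := by simpa [star_eq_conjTranspose] using hL.star
  have h1 : M * D = 0 := hLt.mul_left_eq_zero.1 htr'
  have h2 : D = 0 := hM.mul_right_eq_zero.1 h1
  exact (sub_eq_zero.1 h2).symm

end PosDef

section Stationarity

open Filter Topology

variable {N : ℕ}

lemma hasDerivAt_log_det {A : Matrix (Fin N) (Fin N) ℝ} (hA : A.PosDef)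
    (E : Matrix (Fin N) (Fin N) ℝ) :
    HasDerivAt (fun t : ℝ => Real.log (A + t • E).det) (A⁻¹ * E).trace 0 := by
  have hdet : IsUnit A.det := (isUnit_iff_isUnit_det _).1 hA.isUnit
  let p : Polynomial ℝ := (1 + (Polynomial.X : Polynomial ℝ) • (A⁻¹ * E).map Polynomial.C).det
  have hp (t : ℝ) : p.eval t = (1 + t • (A⁻¹ * E)).det := by
    simp only [p, ← Polynomial.coe_evalRingHom, RingHom.map_det]
    congr 1
    generalize A⁻¹ * E = M
    ext i j
    rcases eq_or_ne i j with rfl | h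
    · simp [mul_comm t]
    · simp [h, mul_comm t]
  have hfac (t : ℝ) : (A + t • E).det = A.det * p.eval t := by
    rw [hp, ← det_mul, mul_add, mul_one, Matrix.mul_smul, ← mul_assoc, mul_nonsing_inv _ hdet, one_mul]
  have hd : HasDerivAt (fun t : ℝ => (A + t • E).det) (A.det * (A⁻¹ * E).trace) 0 := by
    simp only [hfac]
    rw [← derivative_det_one_add_X_smul]
    exact (p.hasDerivAt 0).const_mul _
  have := hd.log (by simpa using hA.det_pos.ne')
  simpa [hA.det_pos.ne'] using this

lemma abs_le_of_hasDerivAt {g : ℝ → ℝ} {g' c : ℝ} (hg : HasDerivAt g g' 0)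
    (h : ∀ᶠ t in 𝓝 (0 : ℝ), g 0 ≤ g t + c * |t|) : |g'| ≤ c := by
  rw [abs_le]
  constructor
  · refine ge_of_tendsto hg.tendsto_slope_zero_right ?_
    filter_upwards [h.filter_mono nhdsWithin_le_nhds, self_mem_nhdsWithin] with t ht ht0
    have ht0 : 0 < t := ht0
    rw [abs_of_pos ht0] at ht
    rw [zero_add, smul_eq_mul, inv_mul_eq_div, le_div_iff₀ ht0]
    linarith
  · refine le_of_tendsto hg.tendsto_slope_zero_left ?_
    filter_upwards [h.filter_mono nhdsWithin_le_nhds, self_mem_nhdsWithin] with t ht ht0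
    have ht0 : t < 0 := ht0
    rw [abs_of_neg ht0] at ht
    rw [zero_add, smul_eq_mul, inv_mul_eq_div, div_le_iff_of_neg ht0]
    linarith

lemma eventually_posDef_add_smul {A E : Matrix (Fin N) (Fin N) ℝ} (hA : A.PosDef)
    (hE : E.IsHermitian) : ∀ᶠ t in 𝓝 (0 : ℝ), (A + t • E).PosDef := by
  have hcont : Continuous fun t : ℝ => |t| * opInf (A⁻¹ * E) := by fun_prop
  have h0 : ∀ᶠ t in 𝓝 (0 : ℝ), |t| * opInf (A⁻¹ * E) < 1 :=
    hcont.continuousAt.eventually_lt_const (by simp)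
  filter_upwards [h0] with t ht
  refine posDef_add_of_opInf_lt_one hA ?_ (by rwa [Matrix.mul_smul, opInf_smul])
  rw [IsHermitian, conjTranspose_smul, hE.eq, star_trivial]

lemma frobInner_add_smul (A B E : Matrix (Fin N) (Fin N) ℝ) (t : ℝ) :
    frobInner A (B + t • E) = frobInner A B + t * frobInner A E := by
  simp only [frobInner, Matrix.add_apply, Matrix.smul_apply, smul_eq_mul, Finset.mul_sum,
    ← Finset.sum_add_distrib]
  exact Finset.sum_congr rfl fun i _ => Finset.sum_congr rfl fun j _ => by ring

lemma frobInner_eq_trace (A B : Matrix (Fin N) (Fin N) ℝ) : frobInner A B = (Aᵀ * B).trace := by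
  simp only [frobInner, trace, diag_apply, mul_apply, transpose_apply]
  exact Finset.sum_comm

lemma matL1Norm_add_smul_le (A E : Matrix (Fin N) (Fin N) ℝ) (t : ℝ) :
    matL1Norm (A + t • E) ≤ matL1Norm A + |t| * matL1Norm E := by
  simp only [matL1Norm, Finset.mul_sum, ← Finset.sum_add_distrib]
  refine Finset.sum_le_sum fun i _ => Finset.sum_le_sum fun j _ => ?_
  rw [← abs_mul]
  exact abs_add_le _ _

/-- First-order optimality of a restricted graphical-lasso minimizer along a symmetric direction. -/
lemma abs_sum_frobInner_le {K : ℕ} {S : Set (Fin N × Fin N)}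
    {Sighat : Fin K → Matrix (Fin N) (Fin N) ℝ} {T : Fin K → ℝ} {lam : ℝ} (hlam : 0 ≤ lam)
    {Ω : Matrix (Fin N) (Fin N) ℝ} (hΩ : Ω.PosDef)
    (hsupp : ∀ p : Fin N × Fin N, p ∉ S → Ω p.1 p.2 = 0)
    (hmin : ∀ M : Matrix (Fin N) (Fin N) ℝ, M.PosDef →
      (∀ p : Fin N × Fin N, p ∉ S → M p.1 p.2 = 0) →
      (∑ k, T k * (frobInner (Sighat k) Ω - Real.log Ω.det)) + lam * matL1Norm Ω ≤
        (∑ k, T k * (frobInner (Sighat k) M - Real.log M.det)) + lam * matL1Norm M)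
    {E : Matrix (Fin N) (Fin N) ℝ} (hE : E.IsHermitian)
    (hEsupp : ∀ p : Fin N × Fin N, p ∉ S → E p.1 p.2 = 0) :
    |∑ k, T k * (frobInner (Sighat k) E - (Ω⁻¹ * E).trace)| ≤ lam * matL1Norm E := by
  have hderiv : HasDerivAt
      (fun t : ℝ => ∑ k, T k * (frobInner (Sighat k) (Ω + t • E) - Real.log (Ω + t • E).det))
      (∑ k, T k * (frobInner (Sighat k) E - (Ω⁻¹ * E).trace)) 0 := by
    refine HasDerivAt.fun_sum fun k _ => HasDerivAt.const_mul _ ?_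
    refine HasDerivAt.sub ?_ (hasDerivAt_log_det hΩ E)
    simp only [frobInner_add_smul]
    simpa using ((hasDerivAt_id (0 : ℝ)).mul_const (frobInner (Sighat k) E)).const_add
      (frobInner (Sighat k) Ω)
  refine abs_le_of_hasDerivAt hderiv ?_
  filter_upwards [eventually_posDef_add_smul hΩ hE] with t ht
  have h1 := hmin _ ht fun p hp => by simp [hsupp p hp, hEsupp p hp]
  have h2 := mul_le_mul_of_nonneg_left (matL1Norm_add_smul_le Ω E t) hlam
  simp only [zero_smul, add_zero]
  linarith

lemma abs_inv_sub_sum_le {K : ℕ} {S : Set (Fin N × Fin N)} (hS : ∀ i j, (i, j) ∈ S → (j, i) ∈ S)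
    {Sighat : Fin K → Matrix (Fin N) (Fin N) ℝ} (hSighat : ∀ k, (Sighat k).IsHermitian)
    {T : Fin K → ℝ} {lam : ℝ} (hlam : 0 ≤ lam)
    {Ω : Matrix (Fin N) (Fin N) ℝ} (hΩ : Ω.PosDef)
    (hsupp : ∀ p : Fin N × Fin N, p ∉ S → Ω p.1 p.2 = 0)
    (hmin : ∀ M : Matrix (Fin N) (Fin N) ℝ, M.PosDef →
      (∀ p : Fin N × Fin N, p ∉ S → M p.1 p.2 = 0) →
      (∑ k, T k * (frobInner (Sighat k) Ω - Real.log Ω.det)) + lam * matL1Norm Ω ≤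
        (∑ k, T k * (frobInner (Sighat k) M - Real.log M.det)) + lam * matL1Norm M)
    {i j : Fin N} (hij : (i, j) ∈ S) :
    |∑ k, T k * (Sighat k i j - Ω⁻¹ i j)| ≤ lam := by
  set E : Matrix (Fin N) (Fin N) ℝ := single i j 1 + single j i 1 with hEdef
  have hE : E.IsHermitian := by
    simp [IsHermitian, hEdef, add_comm]
  have hEsupp (p : Fin N × Fin N) (hp : p ∉ S) : E p.1 p.2 = 0 := by
    have h1 : ¬(i = p.1 ∧ j = p.2) := fun h => hp (by rwa [h.1, h.2] at hij)
    have h2 : ¬(j = p.1 ∧ i = p.2) := fun h => hp (by simpa [h.1, h.2] using hS i j hij)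
    simp [hEdef, h1, h2]
  have htr (M : Matrix (Fin N) (Fin N) ℝ) (hM : M.IsHermitian) : (M * E).trace = 2 * M i j := by
    have : M j i = M i j := by simpa using hM.apply i j
    rw [hEdef, mul_add, trace_add, trace_mul_comm, trace_mul_comm M]
    simp [trace_single_mul, this]
    ring
  have hL1 : matL1Norm E ≤ 2 := by
    have h1 (a b : Fin N) : matL1Norm (single a b (1 : ℝ)) = 1 := by
      unfold matL1Norm
      rw [Finset.sum_eq_single a _ (by simp), Finset.sum_eq_single b _ (by simp)]
      · simp
      · intro b' _ hb
        simp [hb.symm]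
      · intro a' _ ha
        simp [ha.symm]
    have := matL1Norm_add_smul_le (single i j (1 : ℝ)) (single j i 1) 1
    rw [one_smul, h1, h1, abs_one] at this
    linarith
  have h := abs_sum_frobInner_le hlam hΩ hsupp hmin hE hEsupp
  have heq : ∑ k, T k * (frobInner (Sighat k) E - (Ω⁻¹ * E).trace)
      = 2 * ∑ k, T k * (Sighat k i j - Ω⁻¹ i j) := by
    rw [Finset.mul_sum]
    refine Finset.sum_congr rfl fun k _ => ?_
    have hk : (Sighat k)ᵀ = Sighat k := by simpa using (hSighat k).eq
    rw [frobInner_eq_trace, hk, htr _ (hSighat k), htr _ hΩ.inv.isHermitian]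
    ring
  rw [heq, abs_mul, abs_two] at h
  linarith [mul_le_mul_of_nonneg_left hL1 hlam]

end Stationarity

section Residual

variable {N : ℕ}

lemma opInf_inv_add_mul_le {Ω Ψ : Matrix (Fin N) (Fin N) ℝ} (hΩ : Ω.PosDef)
    (hB : (Ω + Ψ).PosDef) {x : ℝ} (hx : opInf Ω⁻¹ * opInf Ψ ≤ x) :
    opInf (Ω + Ψ)⁻¹ * (1 - x) ≤ opInf Ω⁻¹ := by
  have h : (Ω + Ψ)⁻¹ = Ω⁻¹ - Ω⁻¹ * Ψ * (Ω + Ψ)⁻¹ := by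
    have := inv_mul_mul_inv_eq hΩ hB
    rw [add_sub_cancel_left] at this
    rw [← this, sub_sub_cancel]
  have h1 : opInf (Ω + Ψ)⁻¹ ≤ opInf Ω⁻¹ + opInf (Ω⁻¹ * Ψ * (Ω + Ψ)⁻¹) := by
    conv_lhs => rw [h]
    exact opInf_sub_le _ _
  have h2 : opInf (Ω⁻¹ * Ψ * (Ω + Ψ)⁻¹) ≤ x * opInf (Ω + Ψ)⁻¹ :=
    (opInf_mul_le _ _).trans
      (mul_le_mul_of_nonneg_right ((opInf_mul_le _ _).trans hx) (opInf_nonneg _))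
  linarith

lemma inv_add_sub_inv_add_eq {Ω Ψ : Matrix (Fin N) (Fin N) ℝ} (hΩ : Ω.PosDef)
    (hB : (Ω + Ψ).PosDef) :
    (Ω + Ψ)⁻¹ - Ω⁻¹ + Ω⁻¹ * Ψ * Ω⁻¹ = Ω⁻¹ * Ψ * (Ω + Ψ)⁻¹ * Ψ * Ω⁻¹ := by
  have h1 := inv_mul_mul_inv_eq hΩ hB
  have h2 := inv_mul_mul_inv_eq hB hΩ
  rw [add_sub_cancel_left] at h1
  rw [show Ω - (Ω + Ψ) = -Ψ by abel, mul_neg, neg_mul] at h2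
  rw [← h1, h2, sub_mul, sub_mul, ← neg_eq_iff_eq_neg.2 h2]
  abel

lemma elemInf_inv_add_sub_inv_add_le {Ω Ψ : Matrix (Fin N) (Fin N) ℝ} (hΩ : Ω.PosDef)
    (hB : (Ω + Ψ).PosDef) {x : ℝ} (hx : opInf Ω⁻¹ * opInf Ψ ≤ x) (hx1 : x < 1) :
    elemInf ((Ω + Ψ)⁻¹ - Ω⁻¹ + Ω⁻¹ * Ψ * Ω⁻¹) ≤
      (1 - x)⁻¹ * (opInf Ψ * elemInf Ψ * opInf Ω⁻¹ ^ 3) := by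
  have hsym : (Ω⁻¹)ᵀ = Ω⁻¹ := by simpa using hΩ.inv.isHermitian.eq
  have hb := opInf_inv_add_mul_le hΩ hB hx
  rw [← le_div_iff₀ (by linarith)] at hb
  rw [inv_add_sub_inv_add_eq hΩ hB]
  have hκ := opInf_nonneg Ω⁻¹
  have hΨ := opInf_nonneg Ψ
  have hΨ' := elemInf_nonneg Ψ
  calc elemInf (Ω⁻¹ * Ψ * (Ω + Ψ)⁻¹ * Ψ * Ω⁻¹)
      ≤ elemInf (Ω⁻¹ * Ψ * (Ω + Ψ)⁻¹ * Ψ) * opInf Ω⁻¹ := by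
        simpa only [hsym] using elemInf_mul_le_transpose (Ω⁻¹ * Ψ * (Ω + Ψ)⁻¹ * Ψ) Ω⁻¹
    _ ≤ (opInf (Ω⁻¹ * Ψ * (Ω + Ψ)⁻¹) * elemInf Ψ) * opInf Ω⁻¹ := by
        gcongr; exact elemInf_mul_le _ _
    _ ≤ ((opInf (Ω⁻¹ * Ψ) * opInf (Ω + Ψ)⁻¹) * elemInf Ψ) * opInf Ω⁻¹ := by
        gcongr; exact opInf_mul_le _ _
    _ ≤ ((opInf Ω⁻¹ * opInf Ψ * (opInf Ω⁻¹ / (1 - x))) * elemInf Ψ) * opInf Ω⁻¹ := by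
        gcongr
        · exact opInf_nonneg _
        · exact opInf_mul_le _ _
    _ = (1 - x)⁻¹ * (opInf Ψ * elemInf Ψ * opInf Ω⁻¹ ^ 3) := by ring

lemma elemInf_residual_sub_le {Ω Ψ Φ : Matrix (Fin N) (Fin N) ℝ} (hΩ : Ω.PosDef)
    (hB : (Ω + Ψ).PosDef) (hC : (Ω + Φ).PosDef) {δ : ℝ} (hΨ : opInf Ψ ≤ δ) (hΦ : opInf Φ ≤ δ)
    (hδ : opInf Ω⁻¹ * δ ≤ 1 / 4) :
    elemInf (((Ω + Ψ)⁻¹ - Ω⁻¹ + Ω⁻¹ * Ψ * Ω⁻¹) - ((Ω + Φ)⁻¹ - Ω⁻¹ + Ω⁻¹ * Φ * Ω⁻¹)) ≤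
      28 / 9 * (opInf Ω⁻¹ ^ 3 * δ) * elemInf (Ψ - Φ) := by
  have hκ := opInf_nonneg Ω⁻¹
  have hδ0 : 0 ≤ δ := (opInf_nonneg _).trans hΨ
  have hΔ := elemInf_nonneg (Ψ - Φ)
  have hsym : (Ω⁻¹)ᵀ = Ω⁻¹ := by simpa using hΩ.inv.isHermitian.eq
  have hinv {X : Matrix (Fin N) (Fin N) ℝ} (hX : (Ω + X).PosDef) (hXδ : opInf X ≤ δ) :
      opInf (Ω + X)⁻¹ ≤ 4 / 3 * opInf Ω⁻¹ := by
    have := opInf_inv_add_mul_le hΩ hX ((mul_le_mul_of_nonneg_left hXδ hκ).trans hδ)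
    linarith
  have hdiff {X : Matrix (Fin N) (Fin N) ℝ} (hX : (Ω + X).PosDef) (hXδ : opInf X ≤ δ) :
      opInf (Ω⁻¹ - (Ω + X)⁻¹) ≤ 4 / 3 * (opInf Ω⁻¹ ^ 2 * δ) := by
    rw [inv_mul_mul_inv_eq hΩ hX, add_sub_cancel_left]
    calc opInf (Ω⁻¹ * X * (Ω + X)⁻¹) ≤ opInf Ω⁻¹ * opInf X * opInf (Ω + X)⁻¹ :=
          (opInf_mul_le _ _).trans
            (mul_le_mul_of_nonneg_right (opInf_mul_le _ _) (opInf_nonneg _))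
      _ ≤ opInf Ω⁻¹ * δ * (4 / 3 * opInf Ω⁻¹) := by
          gcongr
          · exact opInf_nonneg _
          · exact hinv hX hXδ
      _ = 4 / 3 * (opInf Ω⁻¹ ^ 2 * δ) := by ring
  have hCsym : (Ω⁻¹ - (Ω + Φ)⁻¹)ᵀ = Ω⁻¹ - (Ω + Φ)⁻¹ := by
    simpa using (hΩ.inv.isHermitian.sub hC.inv.isHermitian).eq
  have heq : ((Ω + Ψ)⁻¹ - Ω⁻¹ + Ω⁻¹ * Ψ * Ω⁻¹) - ((Ω + Φ)⁻¹ - Ω⁻¹ + Ω⁻¹ * Φ * Ω⁻¹) =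
      (Ω⁻¹ - (Ω + Ψ)⁻¹) * ((Ψ - Φ) * Ω⁻¹) + (Ω + Ψ)⁻¹ * ((Ψ - Φ) * (Ω⁻¹ - (Ω + Φ)⁻¹)) := by
    have h := inv_mul_mul_inv_eq hC hB
    have h' := inv_mul_mul_inv_eq hB hC
    rw [show Ω + Φ - (Ω + Ψ) = -(Ψ - Φ) by abel, mul_neg, neg_mul] at h'
    calc _ = ((Ω + Ψ)⁻¹ - (Ω + Φ)⁻¹) + Ω⁻¹ * (Ψ - Φ) * Ω⁻¹ := by
          rw [mul_sub, sub_mul]; abel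
      _ = _ := by
          rw [h']
          simp only [sub_mul, mul_sub, mul_assoc]
          abel
  rw [heq]
  refine (elemInf_add_le _ _).trans ?_
  have h1 : elemInf ((Ω⁻¹ - (Ω + Ψ)⁻¹) * ((Ψ - Φ) * Ω⁻¹)) ≤
      4 / 3 * (opInf Ω⁻¹ ^ 2 * δ) * (elemInf (Ψ - Φ) * opInf Ω⁻¹) := by
    refine (elemInf_mul_le _ _).trans ?_
    gcongr
    · exact elemInf_nonneg _
    · exact hdiff hB hΨ
    · simpa only [hsym] using elemInf_mul_le_transpose (Ψ - Φ) Ω⁻¹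
  have h2 : elemInf ((Ω + Ψ)⁻¹ * ((Ψ - Φ) * (Ω⁻¹ - (Ω + Φ)⁻¹))) ≤
      4 / 3 * opInf Ω⁻¹ * (elemInf (Ψ - Φ) * (4 / 3 * (opInf Ω⁻¹ ^ 2 * δ))) := by
    refine (elemInf_mul_le _ _).trans ?_
    gcongr
    · exact elemInf_nonneg _
    · exact hinv hB hΨ
    · refine (elemInf_mul_le_transpose _ _).trans ?_
      rw [hCsym]
      gcongr
      exact hdiff hC hΦ
  linarith

end Residual

section RestrictedSolution

variable {N : ℕ} {S : Set (Fin N × Fin N)}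

/-- The matrix supported on `S` with prescribed entries there. -/
noncomputable def matOfEntries (x : S → ℝ) : Matrix (Fin N) (Fin N) ℝ :=
  fun i j => if h : (i, j) ∈ S then x ⟨(i, j), h⟩ else 0

lemma matOfEntries_of_notMem (x : S → ℝ) (p : Fin N × Fin N) (hp : p ∉ S) :
    matOfEntries x p.1 p.2 = 0 :=
  dif_neg hp

lemma matOfEntries_coe (x : S → ℝ) (p : S) : matOfEntries x p.1.1 p.1.2 = x p :=
  dif_pos p.2

lemma matOfEntries_sub (x y : S → ℝ) :
    matOfEntries x - matOfEntries y = matOfEntries (x - y) := by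
  ext i j
  by_cases h : (i, j) ∈ S <;> simp [matOfEntries, h]

lemma elemInf_matOfEntries_le (x : S → ℝ) : elemInf (matOfEntries x) ≤ ‖x‖ := by
  refine elemInf_le (norm_nonneg _) fun i j => ?_
  by_cases h : (i, j) ∈ S
  · simpa [matOfEntries, h] using norm_le_pi_norm x ⟨(i, j), h⟩
  · simp [matOfEntries, h]

lemma continuous_matOfEntries : Continuous (matOfEntries : (S → ℝ) → Matrix _ _ ℝ) := by
  refine continuous_matrix fun i j => ?_
  by_cases h : (i, j) ∈ S
  · simpa only [matOfEntries, h, dite_true] using continuous_apply _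
  · simpa only [matOfEntries, h, dite_false] using continuous_const

lemma gammaSS_mulVec (Sig : Matrix (Fin N) (Fin N) ℝ) (x : S → ℝ) (p : S) :
    (gammaSS Sig S *ᵥ x) p = (Sig * matOfEntries x * Sigᵀ) p.1.1 p.1.2 := by
  let f : Fin N × Fin N → ℝ := fun q => Sig p.1.1 q.1 * Sig p.1.2 q.2 * matOfEntries x q.1 q.2
  have h : (gammaSS Sig S *ᵥ x) p = ∑ q : S, f q := by
    simp only [mulVec, dotProduct, gammaSS, kron, f, matOfEntries_coe]
  rw [h, Finset.sum_set_coe (f := f), Finset.sum_subset (Finset.subset_univ _), Fintype.sum_prod_type,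
    Finset.sum_comm]
  · simp only [f, mul_apply, transpose_apply, Finset.sum_mul]
    exact Finset.sum_congr rfl fun _ _ => Finset.sum_congr rfl fun _ _ => by ring
  · intro q _ hq
    simp only [f]
    rw [matOfEntries_of_notMem x q (by simpa using hq), mul_zero]

lemma gammaSS_posDef {Sig : Matrix (Fin N) (Fin N) ℝ} (h : Sig.PosDef) :
    (gammaSS Sig S).PosDef :=
  (h.kronecker h).submatrix (e := ((↑) : S → Fin N × Fin N)) Subtype.val_injective

lemma isHermitian_matOfEntries_inv_gammaSS_mulVec {Sig : Matrix (Fin N) (Fin N) ℝ}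
    (hS : ∀ i j, (i, j) ∈ S → (j, i) ∈ S) {u : S → ℝ} (hu : (matOfEntries u).IsHermitian) :
    (matOfEntries ((gammaSS Sig S)⁻¹ *ᵥ u)).IsHermitian := by
  let σ : S ≃ S :=
    { toFun := fun p => ⟨(p.1.2, p.1.1), hS _ _ p.2⟩
      invFun := fun p => ⟨(p.1.2, p.1.1), hS _ _ p.2⟩
      left_inv := fun _ => rfl
      right_inv := fun _ => rfl }
  have hσ (v : S → ℝ) : (matOfEntries v).IsHermitian ↔ v ∘ σ = v := by
    constructor
    · intro h
      funext p
      have := h.apply p.1.1 p.1.2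
      rw [star_trivial, matOfEntries_coe] at this
      rw [← this]
      exact (matOfEntries_coe v (σ p)).symm
    · intro h
      ext i j
      by_cases hij : (i, j) ∈ S
      · simpa [matOfEntries, hij, hS i j hij, σ] using congrFun h ⟨(i, j), hij⟩
      · have hji : (j, i) ∉ S := fun h => hij (hS j i h)
        simp [matOfEntries, hij, hji]
  have hΓ : (gammaSS Sig S).submatrix σ σ = gammaSS Sig S := by
    ext p q
    exact mul_comm _ _
  rw [hσ] at hu ⊢
  have h1 := submatrix_mulVec_equiv (gammaSS Sig S)⁻¹ u σ σ
  rw [← inv_submatrix_equiv, hΓ] at h1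
  have h2 : u ∘ σ.symm = u := hu
  rw [h2] at h1
  exact h1.symm

lemma isHermitian_matOfEntries_coe (hS : ∀ i j, (i, j) ∈ S → (j, i) ∈ S)
    {M : Matrix (Fin N) (Fin N) ℝ} (hM : M.IsHermitian) :
    (matOfEntries fun p : S => M p.1.1 p.1.2).IsHermitian := by
  ext i j
  by_cases hij : (i, j) ∈ S
  · simpa [matOfEntries, hij, hS i j hij] using hM.apply i j
  · have hji : (j, i) ∉ S := fun h => hij (hS j i h)
    simp [matOfEntries, hij, hji]

lemma matSupp_symm {A : Matrix (Fin N) (Fin N) ℝ} (hA : A.IsHermitian) (i j : Fin N)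
    (h : (i, j) ∈ matSupp A) : (j, i) ∈ matSupp A := by
  have hA' : A j i = A i j := by simpa using hA.apply i j
  simpa [matSupp, hA'] using h

/-- Solve `[(Ω + Ψ)⁻¹ - Ω⁻¹]_S = E_S` for a small symmetric `Ψ` supported on `S = supp Ω`, by
contraction: with `r = 2 κ_Γ e`, the map is a contraction of the ball of radius `3 r / 4`. -/
lemma exists_small_solution {Ω E : Matrix (Fin N) (Fin N) ℝ} (hΩ : Ω.PosDef)
    (hE : E.IsHermitian) {e s : ℝ} (he : 0 ≤ e)
    (hEe : ∀ p ∈ matSupp Ω, |E p.1 p.2| ≤ e)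
    (hs : s = 3 / 2 * kappaGamma Ω⁻¹ (matSupp Ω) * e)
    (hs1 : opInf Ω⁻¹ * matDegree Ω * s ≤ 1 / 4)
    (hs2 : opInf Ω⁻¹ ^ 3 * kappaGamma Ω⁻¹ (matSupp Ω) * matDegree Ω * s ≤ 1 / 4) :
    ∃ Ψ : Matrix (Fin N) (Fin N) ℝ, (Ω + Ψ).PosDef ∧
      (∀ p : Fin N × Fin N, p ∉ matSupp Ω → Ψ p.1 p.2 = 0) ∧ elemInf Ψ ≤ s ∧
      ∀ p ∈ matSupp Ω, ((Ω + Ψ)⁻¹ - Ω⁻¹) p.1 p.2 = E p.1 p.2 := by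
  set S := matSupp Ω
  set κ := opInf Ω⁻¹
  set κΓ := kappaGamma Ω⁻¹ S
  set d : ℝ := (matDegree Ω : ℝ)
  have hκ : 0 ≤ κ := opInf_nonneg _
  have hκΓ : 0 ≤ κΓ := opInf_nonneg _
  have hd : 0 ≤ d := Nat.cast_nonneg _
  have hs0 : 0 ≤ s := by rw [hs]; positivity
  have hS := matSupp_symm hΩ.isHermitian
  let R : Matrix (Fin N) (Fin N) ℝ → Matrix (Fin N) (Fin N) ℝ := fun Ψ =>
    (Ω + Ψ)⁻¹ - Ω⁻¹ + Ω⁻¹ * Ψ * Ω⁻¹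
  let F : (S → ℝ) → (S → ℝ) := fun x =>
    (gammaSS Ω⁻¹ S)⁻¹ *ᵥ fun p => (R (matOfEntries x) - E) p.1.1 p.1.2
  let C : Set (S → ℝ) := {x | ‖x‖ ≤ s ∧ (matOfEntries x).IsHermitian}
  have hop {x : S → ℝ} (hx : x ∈ C) : opInf (matOfEntries x) ≤ d * s :=
    (opInf_le_matDegree_mul (matOfEntries_of_notMem x)).trans
      (mul_le_mul_of_nonneg_left ((elemInf_matOfEntries_le x).trans hx.1) hd)
  have hκd : κ * (d * s) ≤ 1 / 4 := by rwa [← mul_assoc]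
  have hPD {x : S → ℝ} (hx : x ∈ C) : (Ω + matOfEntries x).PosDef := by
    refine posDef_add_of_opInf_lt_one hΩ hx.2 ?_
    have h1 := opInf_mul_le Ω⁻¹ (matOfEntries x)
    have h2 := mul_le_mul_of_nonneg_left (hop hx) hκ
    linarith
  have hR {x : S → ℝ} (hx : x ∈ C) : elemInf (R (matOfEntries x)) ≤ 4 / 3 * (κ ^ 3 * d * s * s) := by
    have h := elemInf_inv_add_sub_inv_add_le hΩ (hPD hx)
      ((mul_le_mul_of_nonneg_left (hop hx) hκ).trans hκd) (by norm_num)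
    calc _ ≤ (1 - 1 / 4 : ℝ)⁻¹ * (opInf (matOfEntries x) * elemInf (matOfEntries x) * κ ^ 3) := h
      _ ≤ (1 - 1 / 4 : ℝ)⁻¹ * (d * s * s * κ ^ 3) := by
        gcongr
        · exact elemInf_nonneg _
        · exact hop hx
        · exact (elemInf_matOfEntries_le x).trans hx.1
      _ = 4 / 3 * (κ ^ 3 * d * s * s) := by ring
  have hmaps : Set.MapsTo F C C := by
    intro x hx
    constructor
    · refine (pi_norm_le_iff_of_nonneg hs0).2 fun p => ?_
      have hb (q : S) : |(R (matOfEntries x) - E) q.1.1 q.1.2| ≤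
          4 / 3 * (κ ^ 3 * d * s * s) + e :=
        (abs_sub _ _).trans
          (add_le_add ((abs_le_elemInf _ _ _).trans (hR hx)) (hEe q.1 q.2))
      have h1 : |F x p| ≤ κΓ * (4 / 3 * (κ ^ 3 * d * s * s) + e) := abs_mulVec_le _ hb p
      have h2 := mul_le_mul_of_nonneg_right hs2 hs0
      rw [Real.norm_eq_abs]
      linarith
    · refine isHermitian_matOfEntries_inv_gammaSS_mulVec hS ?_
      have hM : (R (matOfEntries x) - E).IsHermitian := by
        refine IsHermitian.sub (((hPD hx).inv.isHermitian.sub hΩ.inv.isHermitian).add ?_) hE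
        have := isHermitian_mul_mul_conjTranspose Ω⁻¹ hx.2
        rwa [hΩ.inv.isHermitian.eq] at this
      exact isHermitian_matOfEntries_coe hS hM
  have hcontr : ContractingWith (7 / 9) (hmaps.restrict F C C) := by
    refine ⟨by rw [← NNReal.coe_lt_coe]; norm_num, LipschitzWith.of_dist_le_mul fun x y => ?_⟩
    have hxy : dist (x : S → ℝ) y = dist x y := rfl
    change dist (F x) (F y) ≤ _
    rw [← hxy, dist_eq_norm, dist_eq_norm]
    have hF : F x - F y = (gammaSS Ω⁻¹ S)⁻¹ *ᵥ fun p =>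
        (R (matOfEntries x.1) - R (matOfEntries y.1)) p.1.1 p.1.2 := by
      simp only [F]
      rw [← mulVec_sub]
      congr 1
      funext p
      simp
    have hL := elemInf_residual_sub_le hΩ (hPD x.2) (hPD y.2) (hop x.2) (hop y.2) hκd
    rw [matOfEntries_sub] at hL
    have hL' := hL.trans (mul_le_mul_of_nonneg_left (elemInf_matOfEntries_le (x.1 - y.1))
      (by positivity))
    refine (pi_norm_le_iff_of_nonneg (by positivity)).2 fun p => ?_
    rw [hF, Real.norm_eq_abs]
    refine (abs_mulVec_le _ (fun q => (abs_le_elemInf _ _ _).trans hL') p).trans ?_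
    have h2 := mul_le_mul_of_nonneg_right hs2 (norm_nonneg (x.1 - y.1))
    push_cast
    change κΓ * _ ≤ _
    linarith
  have hcomplete : IsComplete C := by
    refine IsClosed.isComplete ((isClosed_le continuous_norm continuous_const).inter ?_)
    exact isClosed_eq continuous_matOfEntries.matrix_conjTranspose continuous_matOfEntries
  have h0 : (0 : S → ℝ) ∈ C := by
    refine ⟨by simpa using hs0, ?_⟩
    ext i j
    simp [matOfEntries]
  obtain ⟨x, hxC, hfix, -⟩ := hcontr.exists_fixedPoint' hcomplete hmaps h0 (edist_ne_top _ _)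
  refine ⟨matOfEntries x, hPD hxC, matOfEntries_of_notMem x,
    (elemInf_matOfEntries_le x).trans hxC.1, fun p hp => ?_⟩
  have hΓ : gammaSS Ω⁻¹ S *ᵥ x = fun p => (R (matOfEntries x) - E) p.1.1 p.1.2 := by
    have hdet := (isUnit_iff_isUnit_det _).1 (gammaSS_posDef (S := S) hΩ.inv).isUnit
    conv_lhs => rw [← hfix.eq]
    rw [mulVec_mulVec, mul_nonsing_inv _ hdet, one_mulVec]
  have h := congrFun hΓ ⟨p, hp⟩
  have hsym : (Ω⁻¹)ᵀ = Ω⁻¹ := by simpa using hΩ.inv.isHermitian.eq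
  rw [gammaSS_mulVec, hsym] at h
  simp only [R, Matrix.sub_apply, Matrix.add_apply] at h ⊢
  linarith

end RestrictedSolution

lemma mul_le_third_of_le_div {a r : ℝ} (ha : 0 ≤ a) (h : r ≤ 1 / (3 * a)) : a * r ≤ 1 / 3 := by
  rcases ha.eq_or_lt with rfl | ha
  · norm_num
  · rw [le_div_iff₀ (by positivity)] at h
    linarith

/-- if `r := 2κ_Γ̄(λ/T + ‖∑_k (T^{(k)}/T)W^{(k)}‖_∞)` satisfies
`r ≤ min{1/(3κ_Σ̄ d), 1/(3κ_Σ̄³κ_Γ̄ d)}`, then `‖Ψ‖_∞ ≤ r` and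
`‖R(Ψ)‖_∞ ≤ (3/2)·d·‖Ψ‖_∞²·κ_Σ̄³`. -/
theorem stmt3 {N K : ℕ}
    (Ωb : Matrix (Fin N) (Fin N) ℝ) (hΩb : Ωb.PosDef)
    (Sighat : Fin K → Matrix (Fin N) (Fin N) ℝ) (hSighat : ∀ k, (Sighat k).IsHermitian)
    (T : Fin K → ℝ) (hT : ∀ k, 0 < T k)
    (lam : ℝ) (hlam : 0 < lam)
    (α : ℝ) (hα : α ∈ Set.Ioc (0 : ℝ) 1)
    (hinc : MutualIncoherence Ωb⁻¹ (matSupp Ωb) α)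
    -- Ω̃ is the restricted estimator
    (Ωt : Matrix (Fin N) (Fin N) ℝ) (hΩtPD : Ωt.PosDef)
    (hΩtsupp : ∀ p : Fin N × Fin N, p ∉ matSupp Ωb → Ωt p.1 p.2 = 0)
    (hΩtmin : ∀ M : Matrix (Fin N) (Fin N) ℝ, M.PosDef →
      (∀ p : Fin N × Fin N, p ∉ matSupp Ωb → M p.1 p.2 = 0) →
      (∑ k, T k * (frobInner (Sighat k) Ωt - Real.log Ωt.det)) + lam * matL1Norm Ωt ≤
        (∑ k, T k * (frobInner (Sighat k) M - Real.log M.det)) + lam * matL1Norm M)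
    -- `r ≤ min{1/(3κ_Σ̄ d), 1/(3κ_Σ̄³κ_Γ̄ d)}`
    (hr : 2 * kappaGamma Ωb⁻¹ (matSupp Ωb) *
        (lam / (∑ k, T k) + elemInf (∑ k, (T k / ∑ k', T k') • (Sighat k - Ωb⁻¹))) ≤
      min (1 / (3 * opInf Ωb⁻¹ * (matDegree Ωb : ℝ)))
        (1 / (3 * opInf Ωb⁻¹ ^ 3 * kappaGamma Ωb⁻¹ (matSupp Ωb) * (matDegree Ωb : ℝ)))) :
    -- conclusions: `‖Ψ‖_∞ ≤ r` and `‖R(Ψ)‖_∞ ≤ (3/2)d‖Ψ‖_∞²κ_Σ̄³`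
    elemInf (Ωt - Ωb) ≤
      2 * kappaGamma Ωb⁻¹ (matSupp Ωb) *
        (lam / (∑ k, T k) + elemInf (∑ k, (T k / ∑ k', T k') • (Sighat k - Ωb⁻¹))) ∧
    elemInf (Ωt⁻¹ - Ωb⁻¹ + Ωb⁻¹ * (Ωt - Ωb) * Ωb⁻¹) ≤
      3 / 2 * (matDegree Ωb : ℝ) * elemInf (Ωt - Ωb) ^ 2 * opInf Ωb⁻¹ ^ 3 := by
  rcases Nat.eq_zero_or_pos N with rfl | hN
  · simp [elemInf, kappaGamma, opInf]
  have : Nonempty (Fin N) := ⟨⟨0, hN⟩⟩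
  have hS := matSupp_symm hΩb.isHermitian
  have hTpos : 0 < ∑ k, T k := by
    rcases isEmpty_or_nonempty (Fin K) with hK | hK
    · have hhalf := hΩtmin ((1 / 2 : ℝ) • Ωt) (hΩtPD.smul (by norm_num))
        fun p hp => by simp [hΩtsupp p hp]
      have hL : matL1Norm ((1 / 2 : ℝ) • Ωt) = 1 / 2 * matL1Norm Ωt := by
        simp [matL1Norm, abs_mul, Finset.mul_sum]
      have hpos : 0 < matL1Norm Ωt := by
        refine Finset.sum_pos (fun i _ => ?_) Finset.univ_nonempty
        exact (abs_pos.2 hΩtPD.diag_pos.ne').trans_le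
          (Finset.single_le_sum (f := fun j => |Ωt i j|) (fun _ _ => abs_nonneg _)
            (Finset.mem_univ i))
      rw [hL] at hhalf
      simp only [Finset.univ_eq_empty, Finset.sum_empty, zero_add] at hhalf
      nlinarith [mul_pos hlam hpos]
    · exact Finset.sum_pos (fun k _ => hT k) Finset.univ_nonempty
  set W := ∑ k, (T k / ∑ k', T k') • (Sighat k - Ωb⁻¹) with hW
  set e := lam / (∑ k, T k) + elemInf W with he
  set κΓ := kappaGamma Ωb⁻¹ (matSupp Ωb)
  have he0 : 0 ≤ e := add_nonneg (div_nonneg hlam.le hTpos.le) (elemInf_nonneg _)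
  have hκ : 0 ≤ opInf Ωb⁻¹ := opInf_nonneg _
  have hκΓ : 0 ≤ κΓ := opInf_nonneg _
  have hd : (0 : ℝ) ≤ matDegree Ωb := Nat.cast_nonneg _
  have hr1 := mul_le_third_of_le_div (a := opInf Ωb⁻¹ * matDegree Ωb) (by positivity)
    (by simpa only [mul_assoc] using hr.trans (min_le_left _ _))
  have hr2 := mul_le_third_of_le_div (a := opInf Ωb⁻¹ ^ 3 * κΓ * matDegree Ωb) (by positivity)
    (by simpa only [mul_assoc] using hr.trans (min_le_right _ _))
  have hEe : ∀ p ∈ matSupp Ωb, |(Ωt⁻¹ - Ωb⁻¹) p.1 p.2| ≤ e := by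
    rintro ⟨i, j⟩ hp
    have h := abs_inv_sub_sum_le hS hSighat hlam.le hΩtPD hΩtsupp hΩtmin hp
    have heq : (Ωt⁻¹ - Ωb⁻¹) i j = W i j - (∑ k, T k * (Sighat k i j - Ωt⁻¹ i j)) / ∑ k, T k := by
      rw [hW, Matrix.sum_apply, Finset.sum_div, ← Finset.sum_sub_distrib]
      have (k : Fin K) : ((T k / ∑ k', T k') • (Sighat k - Ωb⁻¹)) i j -
          T k * (Sighat k i j - Ωt⁻¹ i j) / ∑ k', T k' =
          T k / (∑ k', T k') * (Ωt⁻¹ - Ωb⁻¹) i j := by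
        simp only [Matrix.smul_apply, Matrix.sub_apply, smul_eq_mul]
        ring
      simp only [this]
      rw [← Finset.sum_mul, ← Finset.sum_div, div_self hTpos.ne', one_mul]
    simp only
    rw [heq, he, add_comm]
    refine (abs_sub _ _).trans (add_le_add (abs_le_elemInf W i j) ?_)
    rw [abs_div, abs_of_pos hTpos]
    exact div_le_div_of_nonneg_right h hTpos.le
  obtain ⟨Ψ, hPD, hΨsupp, hΨ, hΨS⟩ := exists_small_solution hΩb
    (hΩtPD.inv.isHermitian.sub hΩb.inv.isHermitian) he0 hEe rfl (by linarith) (by linarith)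
  obtain rfl : Ωt = Ωb + Ψ := by
    refine posDef_eq_of_inv_eqOn hΩtPD hPD (S := matSupp Ωb) (fun p hp => ?_) fun p hp => ?_
    · have : Ωb p.1 p.2 = 0 := by simpa [matSupp] using hp
      rw [hΩtsupp p hp, Matrix.add_apply, this, hΨsupp p hp, add_zero]
    · have := hΨS p hp
      simp only [Matrix.sub_apply] at this
      linarith
  rw [add_sub_cancel_left]
  have hΨr : elemInf Ψ ≤ 2 * κΓ * e := by
    nlinarith [mul_nonneg hκΓ he0]
  refine ⟨hΨr, ?_⟩
  have hop := opInf_le_matDegree_mul hΨsupp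
  have hx : opInf Ωb⁻¹ * opInf Ψ ≤ 1 / 3 :=
    calc opInf Ωb⁻¹ * opInf Ψ ≤ opInf Ωb⁻¹ * (matDegree Ωb * (2 * κΓ * e)) := by
          gcongr
          exact hop.trans (mul_le_mul_of_nonneg_left hΨr hd)
      _ ≤ 1 / 3 := by linarith
  calc _ ≤ (1 - 1 / 3 : ℝ)⁻¹ * (opInf Ψ * elemInf Ψ * opInf Ωb⁻¹ ^ 3) :=
        elemInf_inv_add_sub_inv_add_le hΩb hPD hx (by norm_num)
    _ ≤ (1 - 1 / 3 : ℝ)⁻¹ * (matDegree Ωb * elemInf Ψ * elemInf Ψ * opInf Ωb⁻¹ ^ 3) := by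
        gcongr
        exact elemInf_nonneg _
    _ = 3 / 2 * matDegree Ωb * elemInf Ψ ^ 2 * opInf Ωb⁻¹ ^ 3 := by ring
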